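/- arXiv:2509.11920 — 2 statements merged into one kernel-verified Lean document; each statement's English description precedes it below -/
import Mathlib

section
/- Let Q(X) ← ⊗_{i=1..m} R_i(X_i) be a sum-product query over a commutative semiring K, let P be a pseudo-tree of Q, let A ∈ var(Q), and let Y be a set of variables with con(A) ⊆ Y ⊆ var(Q) ∖ desc⁺(A). Then for every tuple y ∈ dom^Y such that for each atom i there exists x ∈ supp(R_i) with x[X_i ∩ Y] = y[X_i ∩ Y], it holds that ⟦Q[desc⁺(A)|y]⟧ = ⟦Q[desc⁺(A)|y[con(A)]]⟧. -/
open scoped Classical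

noncomputable section

/-- Closed ancestors in the rooted tree given by the parent function `par`. -/
def anccP {V : Type*} (par : V → V) (A : V) : Set V := {B | ∃ n : ℕ, par^[n] A = B}

/-- Proper ancestors. -/
def ancP {V : Type*} (par : V → V) (A : V) : Set V := anccP par A \ {A}

/-- Closed descendants. -/
def desccP {V : Type*} (par : V → V) (A : V) : Set V := {B | A ∈ anccP par B}

/-- Children of a node. -/
def childP {V : Type*} (par : V → V) (A : V) : Set V := {B | par B = A ∧ B ≠ A}

/-- The conditioned semantics `⟦Q[Z|y]⟧(z)` of the sum-product query with atoms `X i` and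
`K`-relations `R i` (relations are represented as functions on total tuples `V → dom`
that depend only on the coordinates in `X i`).  For disjoint `Y`, `Z`:
`⟦Q[Z|y]⟧(z) = ⊗_{i : ∅ ≠ X i∖Y ⊆ Z} R i ((y,z)[X i]) ⊗ ⊗_{other i} [∃ x ∈ supp (R i)
agreeing with (y,z) on X i ∩ (Y ∪ Z)]`. -/
def condSem {V dom K : Type*} [CommSemiring K] {m : ℕ}
    (X : Fin m → Set V) (R : Fin m → (V → dom) → K)
    (Y Z : Set V) (y z : V → dom) : K :=
  (∏ i : Fin m,
    if (X i \ Y).Nonempty ∧ X i \ Y ⊆ Z then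
      R i (fun A => if A ∈ Y then y A else z A)
    else 1) *
  (∏ i : Fin m,
    if (X i \ Y).Nonempty ∧ X i \ Y ⊆ Z then 1
    else if ∃ x : V → dom, R i x ≠ 0 ∧
        ∀ A ∈ X i ∩ (Y ∪ Z), x A = (if A ∈ Y then y A else z A) then (1 : K)
    else 0)

/-- The projected conditioned semantics `⟦Q[Z|y](Z')⟧(z')`, for `Z' ⊆ Z`: the sum of
`⟦Q[Z|y]⟧(z)` over tuples `z ∈ dom^Z` with `z[Z'] = z'`.  Tuples over `Z` are represented
canonically as total functions taking the default value `dflt` outside `Z`. -/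
def condSemProj {V dom K : Type*} [CommSemiring K] {m : ℕ}
    (X : Fin m → Set V) (R : Fin m → (V → dom) → K)
    (Y Z Z' : Set V) (y z' : V → dom) (dflt : dom) : K :=
  ∑ᶠ z ∈ {z : V → dom | (∀ A, A ∉ Z → z A = dflt) ∧ ∀ A ∈ Z', z A = z' A},
    condSem X R Y Z y z

end

/-- The context `con(A)` of a variable `A` in a pseudo-tree: the proper ancestors of `A`
sharing an atom with some closed descendant of `A`. -/
def conSetP {V : Type*} {m : ℕ} (X : Fin m → Set V) (par : V → V) (A : V) : Set V :=
  {B | B ∈ ancP par A ∧ ∃ C ∈ desccP par A, ∃ i, B ∈ X i ∧ C ∈ X i}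

/-- Two closed ancestors of a common node are comparable. -/
theorem anccP_total {V : Type*} {par : V → V} {L B C : V}
    (hB : B ∈ anccP par L) (hC : C ∈ anccP par L) : B ∈ anccP par C ∨ C ∈ anccP par B := by
  obtain ⟨k, rfl⟩ := hB
  obtain ⟨n, rfl⟩ := hC
  rcases le_total n k with h | h
  · exact Or.inl ⟨k - n, by rw [← Function.iterate_add_apply, Nat.sub_add_cancel h]⟩
  · exact Or.inr ⟨n - k, by rw [← Function.iterate_add_apply, Nat.sub_add_cancel h]⟩

theorem anccP_trans {V : Type*} {par : V → V} {A B C : V}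
    (hAB : A ∈ anccP par B) (hBC : B ∈ anccP par C) : A ∈ anccP par C := by
  obtain ⟨k, rfl⟩ := hAB
  obtain ⟨n, rfl⟩ := hBC
  exact ⟨k + n, Function.iterate_add_apply _ _ _ _⟩

/-- In a pseudo-tree, an atom meeting the closed descendants of `A` has all its other
variables in the context of `A`. -/
theorem mem_conSetP_of_atom {V : Type*} {m : ℕ} {X : Fin m → Set V} {par : V → V}
    (hPT : ∀ i, ∃ A : V, X i ⊆ anccP par A) {A B C : V} {i : Fin m}
    (hC : C ∈ X i) (hCA : C ∈ desccP par A) (hB : B ∈ X i) (hBA : B ∉ desccP par A) :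
    B ∈ conSetP X par A := by
  obtain ⟨L, hL⟩ := hPT i
  have hBanc : B ∈ anccP par A :=
    (anccP_total (hL hB) (anccP_trans hCA (hL hC))).resolve_right hBA
  refine ⟨⟨hBanc, ?_⟩, C, hCA, i, hB, hC⟩
  rintro rfl
  exact hBA ⟨0, rfl⟩

/-- The conditioned semantics depends on the conditioning set `Y` only through a subset `W`
of it, provided that atoms meeting `Z` do not distinguish `W` from `Y` and the other atoms
are supported on `Y`. -/
theorem condSem_eq_of_subset {V dom K : Type*} [CommSemiring K] {m : ℕ}
    {X : Fin m → Set V} {R : Fin m → (V → dom) → K}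
    (hdep : ∀ (i : Fin m) (v w : V → dom), (∀ A ∈ X i, v A = w A) → R i v = R i w)
    {W Y Z : Set V} (hWY : W ⊆ Y) {y : V → dom}
    (hW : ∀ i, (X i ∩ Z).Nonempty → X i ∩ Y ⊆ W)
    (hy : ∀ i, ∃ x : V → dom, R i x ≠ 0 ∧ ∀ B ∈ X i ∩ Y, x B = y B) (z : V → dom) :
    condSem X R Y Z y z = condSem X R W Z y z := by
  have key : ∀ i, (X i ∩ Z).Nonempty → ∀ B ∈ X i, (B ∈ Y ↔ B ∈ W) :=
    fun i hi B hB => ⟨fun h => hW i hi ⟨hB, h⟩, fun h => hWY h⟩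
  have guard_inter : ∀ i (U : Set V), (X i \ U).Nonempty ∧ X i \ U ⊆ Z → (X i ∩ Z).Nonempty :=
    fun i U ⟨⟨B, hB⟩, h⟩ => ⟨B, hB.1, h hB⟩
  have hguard : ∀ i, ((X i \ Y).Nonempty ∧ X i \ Y ⊆ Z) ↔
      ((X i \ W).Nonempty ∧ X i \ W ⊆ Z) := by
    intro i
    by_cases hi : (X i ∩ Z).Nonempty
    · have : X i \ Y = X i \ W :=
        Set.ext fun B => and_congr_right fun hB => not_congr (key i hi B hB)
      rw [this]
    · exact iff_of_false (fun h => hi (guard_inter i Y h)) (fun h => hi (guard_inter i W h))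
  unfold condSem
  congr 1 <;> refine Finset.prod_congr rfl fun i _ => ?_
  · refine if_ctx_congr (hguard i) (fun h => hdep i _ _ fun B hB => ?_) fun _ => rfl
    exact if_congr (key i (guard_inter i W h) B hB) rfl rfl
  · refine if_congr (hguard i) rfl (if_congr ?_ rfl rfl)
    by_cases hi : (X i ∩ Z).Nonempty
    · refine exists_congr fun x => and_congr_right fun _ => forall_congr' fun B => ?_
      by_cases hB : B ∈ X i
      · simp only [Set.mem_inter_iff, Set.mem_union, key i hi B hB]
      · simp [hB]
    · obtain ⟨x, hx0, hx⟩ := hy i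
      refine iff_of_true ⟨x, hx0, ?_⟩ ⟨x, hx0, ?_⟩
      · rintro B ⟨hB, hBY | hBZ⟩
        · rw [if_pos hBY, hx B ⟨hB, hBY⟩]
        · exact absurd ⟨B, hB, hBZ⟩ hi
      · rintro B ⟨hB, hBW | hBZ⟩
        · rw [if_pos hBW, hx B ⟨hB, hWY hBW⟩]
        · exact absurd ⟨B, hB, hBZ⟩ hi

/-- Lemma `app:con`.  For a sum-product query over a commutative
semiring `K`, a pseudo-tree `(root, par)`, a variable `A`, and a set of variables `Y` with
`con(A) ⊆ Y ⊆ var(Q) ∖ desc⁺(A)`: for every tuple `y` such that each atom has a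
supporting tuple agreeing with `y` on `X i ∩ Y`, the conditioned semantics satisfies
`⟦Q[desc⁺(A)|y]⟧ = ⟦Q[desc⁺(A)|y[con(A)]]⟧` (equality of `K`-relations over `desc⁺(A)`,
i.e. evaluated at every `z`). -/
theorem stmt_3 {V dom K : Type*} [CommSemiring K] [Fintype V] [DecidableEq V]
    [Infinite dom] (dflt : dom)
    {m : ℕ} (X : Fin m → Set V)
    (R : Fin m → (V → dom) → K)
    (hdep : ∀ (i : Fin m) (v w : V → dom), (∀ A ∈ X i, v A = w A) → R i v = R i w)
    (hfin : ∀ i, {v : V → dom | R i v ≠ 0 ∧ ∀ A, A ∉ X i → v A = dflt}.Finite)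
    (hvar : ∀ A : V, ∃ i, A ∈ X i)
    (root : V) (par : V → V)
    (hT : par root = root ∧ ∀ A : V, ∃ n : ℕ, par^[n] A = root)
    (hPT : ∀ i, ∃ A : V, X i ⊆ anccP par A)
    (A : V) (Y : Set V)
    (hY1 : conSetP X par A ⊆ Y) (hY2 : Y ⊆ Set.univ \ desccP par A)
    (y : V → dom)
    (hy : ∀ i, ∃ x : V → dom, R i x ≠ 0 ∧ ∀ B ∈ X i ∩ Y, x B = y B) :
    ∀ z : V → dom,
      condSem X R Y (desccP par A) y z
        = condSem X R (conSetP X par A) (desccP par A) y z := by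
  have hYA : ∀ B ∈ Y, B ∉ desccP par A := fun B hB => (hY2 hB).2
  refine condSem_eq_of_subset hdep hY1 ?_ hy
  rintro i ⟨C, hC, hCA⟩ B ⟨hB, hBY⟩
  exact mem_conSetP_of_atom hPT hC hCA hB (hYA B hBY)
end

section
/- Let Q₃ be the scalar 3-path query hypergraph with variables V = {A, B, C}, atoms {A,B}, {B,C}, and output variables X = ∅. Then: (i) the pseudo-tree with root B and children A and C has s = 0 and t = 1; and (ii) every tree decomposition (T, χ) of Q₃ has TD(GJ) space exponent ≥ 1 or TD(GJ) time exponent ≥ 2. -/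
open scoped Classical

noncomputable section

/-- The fractional edge cover number `ρ*(Y)` of a set `Y` of variables, with respect to the
atoms `X i` (each a finite set of variables). -/
def rhoStar {V ι : Type*} [Fintype ι] [DecidableEq V]
    (X : ι → Finset V) (Y : Set V) : ℝ :=
  sInf {r : ℝ | ∃ w : ι → ℝ, (∀ i, 0 ≤ w i) ∧
    (∀ A ∈ Y, 1 ≤ ∑ i ∈ Finset.univ.filter (fun i => A ∈ X i), w i) ∧ r = ∑ i, w i}

/-- Closed ancestors `anc⁺(A)` in the rooted tree given by the parent function `par`. -/
def ancc {V : Type*} (par : V → V) (A : V) : Set V := {B | ∃ n : ℕ, par^[n] A = B}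

/-- Proper ancestors `anc(A)`. -/
def anc {V : Type*} (par : V → V) (A : V) : Set V := ancc par A \ {A}

/-- Closed descendants `desc⁺(A)`. -/
def descc {V : Type*} (par : V → V) (A : V) : Set V := {B | A ∈ ancc par B}

/-- Proper descendants `desc(A)`. -/
def descO {V : Type*} (par : V → V) (A : V) : Set V := {B | A ∈ anc par B}

/-- `(root, par)` describes a rooted tree: the root is a fixed point of the parent map and
every node reaches the root by iterating the parent map. -/
def IsRootedTree {V : Type*} (root : V) (par : V → V) : Prop :=
  par root = root ∧ ∀ A : V, ∃ n : ℕ, par^[n] A = root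

/-- The rooted tree given by `par` is a pseudo-tree of the query with atoms `X`:
every atom is contained in some branch. -/
def IsPseudoTree {V ι : Type*} (X : ι → Finset V) (par : V → V) : Prop :=
  ∀ i, ∃ A : V, (X i : Set V) ⊆ ancc par A

/-- Space exponent `s(P)` of a pseudo-tree. -/
def sExp {V ι : Type*} [Fintype V] [Fintype ι] [DecidableEq V]
    (X : ι → Finset V) (Xout : Set V) (par : V → V) : ℝ :=
  ⨆ A : V, rhoStar X (descc par A ∩ Xout)

/-- Time exponent `t(P)` of a pseudo-tree. -/
def tExp {V ι : Type*} [Fintype V] [Fintype ι] [DecidableEq V]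
    (X : ι → Finset V) (Xout : Set V) (par : V → V) : ℝ :=
  ⨆ A : V, rhoStar X (ancc par A ∪ (descO par A ∩ Xout))

/-- `(root, par, χ)` is a tree decomposition of the query with atoms `X` and output
variables `Xout`: the output variables are contained in the root bag, for every variable
the set of bags containing it is connected (expressed via a common ancestor `t` whose
paths down to the two given bags are fully covered), and every atom is covered by a bag. -/
def IsTreeDecomp {V ν ι : Type*} (X : ι → Finset V) (Xout : Set V)
    (root : ν) (par : ν → ν) (χ : ν → Set V) : Prop :=
  Xout ⊆ χ root ∧
  (∀ (A : V) (v w : ν), A ∈ χ v → A ∈ χ w →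
    ∃ t : ν, A ∈ χ t ∧ t ∈ ancc par v ∧ t ∈ ancc par w ∧
      (∀ u : ν, u ∈ ancc par v → t ∈ ancc par u → A ∈ χ u) ∧
      (∀ u : ν, u ∈ ancc par w → t ∈ ancc par u → A ∈ χ u)) ∧
  (∀ i, ∃ v : ν, (X i : Set V) ⊆ χ v)

/-- The `TD(GJ)` space exponent of a tree decomposition:
`max(ρ*(X), max over tree edges (u,v) of ρ*(χ(u) ∩ χ(v)))`. -/
def tdSpace {V ν ι : Type*} [Fintype ν] [Fintype ι] [DecidableEq V]
    (X : ι → Finset V) (Xout : Set V) (root : ν) (par : ν → ν) (χ : ν → Set V) : ℝ :=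
  max (rhoStar X Xout) (⨆ v : {v : ν // v ≠ root}, rhoStar X (χ (par v.1) ∩ χ v.1))

/-- The `TD(GJ)` time exponent of a tree decomposition: `max_v ρ*(χ(v))`. -/
def tdTime {V ν ι : Type*} [Fintype ν] [Fintype ι] [DecidableEq V]
    (X : ι → Finset V) (χ : ν → Set V) : ℝ :=
  ⨆ v : ν, rhoStar X (χ v)

/-- The fractional hypertree width: the infimum of `max_v ρ*(χ(v))` over all (finite)
tree decompositions, encoded with node sets `Fin n`. -/
def fhw {V ι : Type*} [Fintype V] [Fintype ι] [DecidableEq V]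
    (X : ι → Finset V) (Xout : Set V) : ℝ :=
  sInf {r : ℝ | ∃ (n : ℕ) (root : Fin n) (par : Fin n → Fin n) (χ : Fin n → Set V),
    IsRootedTree root par ∧ IsTreeDecomp X Xout root par χ ∧ r = tdTime X χ}

/-- The context `con(A)` of a variable in a pseudo-tree: those proper ancestors `B` of `A`
that share an atom with some closed descendant of `A`. -/
def conSet {V ι : Type*} (X : ι → Finset V) (par : V → V) (A : V) : Set V :=
  {B | B ∈ anc par A ∧ ∃ C ∈ descc par A, ∃ i, B ∈ X i ∧ C ∈ X i}

/-- `B_A`: the deepest cached closed ancestor of `A` (the element of `C ∩ anc⁺(A)` of which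
all other elements of `C ∩ anc⁺(A)` are closed ancestors). -/
def lowestCache {V : Type*} (par : V → V) (C : Set V) (A : V) : V :=
  if h : ∃ B, (B ∈ C ∩ ancc par A) ∧ C ∩ ancc par A ⊆ ancc par B then h.choose else A

/-- Space exponent of a pseudo-tree with caching `(P, C)`. -/
def sPTC {V ι : Type*} [Fintype V] [Fintype ι] [DecidableEq V]
    (X : ι → Finset V) (Xout : Set V) (par : V → V) (C : Set V) : ℝ :=
  ⨆ A : ↥C, rhoStar X (conSet X par A.1 ∪ (descc par A.1 ∩ Xout))

/-- Time exponent of a pseudo-tree with caching `(P, C)`: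
`max_A ρ*(con(B_A) ∪ [A, B_A] ∪ out(A))`. -/
def tPTC {V ι : Type*} [Fintype V] [Fintype ι] [DecidableEq V]
    (X : ι → Finset V) (Xout : Set V) (par : V → V) (C : Set V) : ℝ :=
  ⨆ A : V, rhoStar X (conSet X par (lowestCache par C A)
    ∪ {u | u ∈ ancc par A ∧ lowestCache par C A ∈ ancc par u}
    ∪ (descO par A ∩ Xout))

/-- Depth of a node in the rooted tree. -/
def tdepth {V : Type*} (root : V) (par : V → V) (A : V) : ℕ :=
  sInf {n : ℕ | par^[n] A = root}

/-- The stored context `scon(A)` of a PTCR `(P, C)`: the `min(C A, |con(A)|)` deepest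
elements of `con(A)`. -/
def sconSet {V ι : Type*} (X : ι → Finset V) (root : V) (par : V → V)
    (Csize : V → ℕ) (A : V) : Set V :=
  {B | B ∈ conSet X par A ∧
    Set.ncard {B' | B' ∈ conSet X par A ∧ tdepth root par B < tdepth root par B'}
      < min (Csize A) (conSet X par A).ncard}

/-- The instantiated context `icon(A)` of a PTCR `(P, C)`. -/
def iconSet {V ι : Type*} (X : ι → Finset V) (root : V) (par : V → V)
    (Csize : V → ℕ) (A : V) : Set V :=
  conSet X par A \ sconSet X root par Csize A

/-- Space exponent of a PTCR: `max_A ρ*(scon(A) ∪ out⁺(A))`. -/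
def sPTCR {V ι : Type*} [Fintype V] [Fintype ι] [DecidableEq V]
    (X : ι → Finset V) (Xout : Set V) (root : V) (par : V → V) (Csize : V → ℕ) : ℝ :=
  ⨆ A : V, rhoStar X (sconSet X root par Csize A ∪ (descc par A ∩ Xout))

/-- Time exponent of a PTCR: `max_A ρ*(ra(A) ∪ out(A))`, where the relevant-ancestor
function `ra` is supplied (it is determined by its defining top-down recurrence). -/
def tPTCR {V ι : Type*} [Fintype V] [Fintype ι] [DecidableEq V]
    (X : ι → Finset V) (Xout : Set V) (par : V → V) (ra : V → Set V) : ℝ :=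
  ⨆ A : V, rhoStar X (ra A ∪ (descO par A ∩ Xout))

end

section

variable {V ι : Type*} [Fintype ι] [DecidableEq V] {X : ι → Finset V} {Y : Set V}

/-- Every fractional edge cover bounds `ρ*` from above. -/
lemma rhoStar_le_sum (w : ι → ℝ) (hw : ∀ i, 0 ≤ w i)
    (hcov : ∀ A ∈ Y, 1 ≤ ∑ i ∈ Finset.univ.filter (fun i => A ∈ X i), w i) :
    rhoStar X Y ≤ ∑ i, w i := by
  refine csInf_le ⟨0, ?_⟩ ⟨w, hw, hcov, rfl⟩
  rintro r ⟨w', hw', -, rfl⟩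
  exact Finset.sum_nonneg fun i _ => hw' i

/-- A common lower bound of all fractional edge covers bounds `ρ*` from below, provided that
every variable of `Y` lies in some atom. -/
lemma le_rhoStar {r : ℝ} (hY : ∀ A ∈ Y, ∃ i, A ∈ X i)
    (h : ∀ w : ι → ℝ, (∀ i, 0 ≤ w i) →
      (∀ A ∈ Y, 1 ≤ ∑ i ∈ Finset.univ.filter (fun i => A ∈ X i), w i) → r ≤ ∑ i, w i) :
    r ≤ rhoStar X Y := by
  refine le_csInf ⟨_, fun _ => 1, fun _ => zero_le_one, fun A hA => ?_, rfl⟩ ?_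
  · obtain ⟨i, hi⟩ := hY A hA
    exact Finset.single_le_sum (f := fun _ => (1 : ℝ)) (fun _ _ => zero_le_one)
      (Finset.mem_filter.2 ⟨Finset.mem_univ i, hi⟩)
  · rintro s ⟨w, hw, hcov, rfl⟩
    exact h w hw hcov

lemma rhoStar_empty : rhoStar X (∅ : Set V) = 0 := by
  refine le_antisymm ?_ (le_rhoStar (by simp) fun w hw _ => Finset.sum_nonneg fun i _ => hw i)
  simpa using rhoStar_le_sum (X := X) (Y := ∅) (fun _ => 0) (by simp) (by simp)

lemma one_le_rhoStar (hY : ∀ A ∈ Y, ∃ i, A ∈ X i) (hne : Y.Nonempty) : 1 ≤ rhoStar X Y := by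
  obtain ⟨A, hA⟩ := hne
  exact le_rhoStar hY fun w hw hcov => (hcov A hA).trans <|
    Finset.sum_le_sum_of_subset_of_nonneg (Finset.filter_subset _ _) fun i _ _ => hw i

/-- If no atom contains both `A` and `B`, then covering `A` and `B` costs at least `2`. -/
lemma two_le_rhoStar (hY : ∀ A ∈ Y, ∃ i, A ∈ X i) {A B : V} (hA : A ∈ Y) (hB : B ∈ Y)
    (hAB : ∀ i, A ∈ X i → B ∉ X i) : 2 ≤ rhoStar X Y := by
  refine le_rhoStar hY fun w hw hcov => ?_
  have hdisj : Disjoint (Finset.univ.filter fun i => A ∈ X i)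
      (Finset.univ.filter fun i => B ∈ X i) :=
    Finset.disjoint_filter.2 fun i _ => hAB i
  calc (2 : ℝ) = 1 + 1 := by norm_num
    _ ≤ _ := add_le_add (hcov A hA) (hcov B hB)
    _ = _ := (Finset.sum_union hdisj).symm
    _ ≤ ∑ i, w i :=
      Finset.sum_le_sum_of_subset_of_nonneg (Finset.subset_univ _) fun i _ _ => hw i

lemma rhoStar_le_one {i : ι} (hi : Y ⊆ X i) : rhoStar X Y ≤ 1 := by
  have h := rhoStar_le_sum (X := X) (Y := Y) (fun j => if j = i then 1 else 0)
    (fun j => by split_ifs <;> norm_num) fun A hA => by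
      have : A ∈ X i := hi hA
      simp [Finset.sum_ite_eq', this]
  simpa using h

end

lemma mem_ancc_self {V : Type*} (par : V → V) (A : V) : A ∈ ancc par A := ⟨0, rfl⟩

lemma par_mem_ancc {V : Type*} (par : V → V) (A : V) : par A ∈ ancc par A := ⟨1, rfl⟩

lemma mem_ancc_par_of_ne {V : Type*} {par : V → V} {A B : V} (h : B ∈ ancc par A) (hne : B ≠ A) :
    B ∈ ancc par (par A) := by
  obtain ⟨_ | n, hn⟩ := h
  · exact absurd hn.symm hne
  · exact ⟨n, hn⟩

lemma eq_of_mem_ancc_of_fixed {V : Type*} {par : V → V} {A B : V} (hA : par A = A)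
    (h : B ∈ ancc par A) : B = A := by
  obtain ⟨n, rfl⟩ := h
  exact Function.iterate_fixed hA n

/-- If `A` occurs in two distinct bags of a tree decomposition, then it occurs in both ends of
some tree edge. -/
lemma IsTreeDecomp.exists_edge_mem {V ν ι : Type*} {X : ι → Finset V} {Xout : Set V}
    {root : ν} {par : ν → ν} {χ : ν → Set V} (hroot : par root = root)
    (h : IsTreeDecomp X Xout root par χ) {A : V} {v w : ν} (hv : A ∈ χ v) (hw : A ∈ χ w)
    (hvw : v ≠ w) : ∃ u, u ≠ root ∧ A ∈ χ (par u) ∩ χ u := by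
  obtain ⟨t, -, htv, htw, hpv, hpw⟩ := h.2.1 A v w hv hw
  have key : ∀ u : ν, A ∈ χ u → t ∈ ancc par u → t ≠ u →
      (∀ x, x ∈ ancc par u → t ∈ ancc par x → A ∈ χ x) →
      ∃ u, u ≠ root ∧ A ∈ χ (par u) ∩ χ u := by
    intro u hu htu hne hp
    refine ⟨u, ?_, hp _ (par_mem_ancc par u) (mem_ancc_par_of_ne htu hne), hu⟩
    rintro rfl
    exact hne (eq_of_mem_ancc_of_fixed hroot htu)
  by_cases htv' : t = v
  · exact key w hw htw (fun htw' => hvw (htv'.symm.trans htw')) hpw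
  · exact key v hv htv htv' hpv

/-- For the scalar 3-path query (`V = {a,b,c}`, atoms `{a,b}`, `{b,c}`,
output variables `∅`):
(i) the pseudo-tree with root `b` and children `a`, `c` (parent map constantly `b`) has
`s = 0` and `t = 1`; and (ii) every tree decomposition has `TD(GJ)` space exponent `≥ 1`
or `TD(GJ)` time exponent `≥ 2`. -/
theorem stmt_10 {V : Type*} [Fintype V] [DecidableEq V]
    (a b c : V) (hab : a ≠ b) (hac : a ≠ c) (hbc : b ≠ c)
    (hV : ∀ x : V, x = a ∨ x = b ∨ x = c)
    (X : Fin 2 → Finset V)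
    (hX : X 0 = {a, b} ∧ X 1 = {b, c}) :
    (IsRootedTree b (fun _ : V => b) ∧ IsPseudoTree X (fun _ : V => b) ∧
      sExp X (∅ : Set V) (fun _ : V => b) = 0 ∧
      tExp X (∅ : Set V) (fun _ : V => b) = 1) ∧
    (∀ (ν : Type) (_ : Fintype ν) (root : ν) (par : ν → ν) (χ : ν → Set V),
      IsRootedTree root par → IsTreeDecomp X (∅ : Set V) root par χ →
      1 ≤ tdSpace X (∅ : Set V) root par χ ∨ 2 ≤ tdTime X χ) := by
  obtain ⟨h0, h1⟩ := hX
  have hcover : ∀ Y : Set V, ∀ A ∈ Y, ∃ i, A ∈ X i := by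
    intro _ A _
    rcases hV A with rfl | rfl | rfl
    · exact ⟨0, by simp [h0]⟩
    · exact ⟨0, by simp [h0]⟩
    · exact ⟨1, by simp [h1]⟩
  have hb : ∀ A, b ∈ ancc (fun _ : V => b) A := par_mem_ancc _
  have hsub : ∀ A, ancc (fun _ : V => b) A ⊆ {A, b} := by
    rintro A _ ⟨_ | n, rfl⟩
    · simp
    · simp [Function.iterate_succ_apply']
  have hne : Nonempty V := ⟨b⟩
  refine ⟨⟨⟨rfl, fun A => hb A⟩, ?_, ?_, ?_⟩, ?_⟩
  · intro i
    fin_cases i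
    · refine ⟨a, fun x hx => ?_⟩
      have hx' : x = a ∨ x = b := by simpa [h0] using hx
      rcases hx' with rfl | rfl
      exacts [mem_ancc_self _ _, hb _]
    · refine ⟨c, fun x hx => ?_⟩
      have hx' : x = b ∨ x = c := by simpa [h1] using hx
      rcases hx' with rfl | rfl
      exacts [hb _, mem_ancc_self _ _]
  · simp [sExp, rhoStar_empty]
  · have hone : ∀ A, rhoStar X (ancc (fun _ : V => b) A) = 1 := by
      intro A
      refine le_antisymm ?_ (one_le_rhoStar (hcover _) ⟨b, hb A⟩)
      have hi : ∃ i, ({A, b} : Set V) ⊆ X i := by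
        rcases hV A with rfl | rfl | rfl
        · exact ⟨0, by simp [h0]⟩
        · exact ⟨0, by simp [h0]⟩
        · exact ⟨1, by simp [h1, Set.pair_comm]⟩
      obtain ⟨i, hi⟩ := hi
      exact rhoStar_le_one ((hsub A).trans hi)
    simp [tExp, hone]
  · intro ν _ root par χ hT hD
    obtain ⟨v, hv⟩ := hD.2.2 0
    obtain ⟨w, hw⟩ := hD.2.2 1
    have hav : a ∈ χ v := hv (by simp [h0])
    have hbv : b ∈ χ v := hv (by simp [h0])
    have hbw : b ∈ χ w := hw (by simp [h1])
    have hcw : c ∈ χ w := hw (by simp [h1])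
    by_cases hvw : v = w
    · subst hvw
      right
      refine (two_le_rhoStar (hcover _) hav hcw fun i => ?_).trans
        (le_ciSup (f := fun v => rhoStar X (χ v)) (Set.finite_range _).bddAbove v)
      fin_cases i
      · intro _
        simp [h0, hac.symm, hbc.symm]
      · intro h
        simp [h1, hab, hac] at h
    · left
      obtain ⟨u, hu, hbu⟩ := hD.exists_edge_mem hT.1 hbv hbw hvw
      refine le_max_of_le_right ((one_le_rhoStar (hcover _) ⟨b, hbu⟩).trans ?_)
      exact le_ciSup (f := fun v : {v : ν // v ≠ root} => rhoStar X (χ (par v.1) ∩ χ v.1))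
        (Set.finite_range _).bddAbove ⟨u, hu⟩
end
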